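/- Let a > 0. There is no C² function f : (0,1) → ℝ with e^{-a} < f(r) < 1 for all r ∈ (0,1), satisfying the ODE f''(r) + f'(r)/r − f(r)/r² − [sin((π/a)·ln f(r)) + (π/a)·cos((π/a)·ln f(r))]/(f(r)·sin((π/a)·ln f(r))) · ( f'(r)² − f(r)²/r² ) = 0 on (0,1), and satisfying either (f'(r) > 0 for all r ∈ (0,1), lim_{r→0⁺} f(r) = e^{-a}, lim_{r→1⁻} f(r) = 1) or (f'(r) < 0 for all r ∈ (0,1), lim_{r→0⁺} f(r) = 1, lim_{r→1⁻} f(r) = e^{-a}). -/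

import Mathlib

open Real Set Filter Topology

/-- First integral of the harmonic map equation: along a solution, with `q = r f' / f` and
`S = sin (k log f)`, the quantity `(q ^ 2 - 1) / S ^ 2` has zero derivative. -/
theorem hasDerivAt_firstIntegral {f : ℝ → ℝ} {k r f'' : ℝ} (hr : 0 < r) (hf : 0 < f r)
    (h1 : HasDerivAt f (deriv f r) r) (h2 : HasDerivAt (deriv f) f'' r)
    (hS : sin (k * log (f r)) ≠ 0)
    (hode : f'' + deriv f r / r - f r / r ^ 2 -
      (sin (k * log (f r)) + k * cos (k * log (f r))) / (f r * sin (k * log (f r))) *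
        ((deriv f r) ^ 2 - (f r) ^ 2 / r ^ 2) = 0) :
    HasDerivAt (fun x => ((x * deriv f x / f x) ^ 2 - 1) / sin (k * log (f x)) ^ 2) 0 r := by
  have hq := ((hasDerivAt_id r).mul h2).div h1 hf.ne'
  have hs := ((h1.log hf.ne').const_mul k).sin
  have hG := ((hq.pow 2).sub_const 1).div (hs.pow 2) (pow_ne_zero 2 hS)
  refine hG.congr_deriv ?_
  simp only [id, Pi.mul_apply, Pi.pow_apply, Pi.div_apply]
  generalize sin (k * log (f r)) = S at *
  generalize cos (k * log (f r)) = C at *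
  generalize deriv f r = p at *
  generalize f r = y at *
  clear hG hq hs h1 h2
  have hy := hf.ne'
  have hr' := hr.ne'
  field_simp at hode ⊢
  push_cast
  field_simp
  linear_combination 2 * p * hode

/-- A positive function on `(0, 1)`, with logarithm bounded by `a` in absolute value, cannot have
logarithmic derivative of constant sign `e` and of size at least `1 / (2 r)` near `0`. -/
theorem not_eventually_half_le_mul_deriv_div {f : ℝ → ℝ} {a e : ℝ}
    (hd : ∀ r ∈ Ioo (0 : ℝ) 1, DifferentiableAt ℝ f r)
    (hf : ∀ r ∈ Ioo (0 : ℝ) 1, 0 < f r) (hb : ∀ r ∈ Ioo (0 : ℝ) 1, -a ≤ e * log (f r)) :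
    ¬ ∀ᶠ r in 𝓝[>] (0 : ℝ), 1 / 2 ≤ e * (r * deriv f r / f r) := by
  intro h
  obtain ⟨d, hd0, hdS⟩ := mem_nhdsGT_iff_exists_Ioo_subset.1
    (h.and (Ioo_mem_nhdsGT (zero_lt_one' ℝ)))
  have hder : ∀ x ∈ Ioo 0 d, HasDerivAt (fun r => e * log (f r) - 1 / 2 * log r)
      (e * (deriv f x / f x) - 1 / 2 * x⁻¹) x := fun x hx =>
    (((hd x (hdS hx).2).hasDerivAt.log (hf x (hdS hx).2).ne').const_mul e).sub
      ((hasDerivAt_log hx.1.ne').const_mul _)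
  have hmono : MonotoneOn (fun r => e * log (f r) - 1 / 2 * log r) (Ioo 0 d) := by
    refine monotoneOn_of_deriv_nonneg (convex_Ioo 0 d)
      (fun x hx => (hder x hx).continuousAt.continuousWithinAt) ?_ ?_
    · intro x hx
      rw [interior_Ioo] at hx
      exact (hder x hx).differentiableAt.differentiableWithinAt
    · intro x hx
      rw [interior_Ioo] at hx
      rw [(hder x hx).deriv]
      have hx0 : x ≠ 0 := hx.1.ne'
      have h1 : 1 / 2 ≤ e * (x * deriv f x / f x) := (hdS hx).1
      have h2 := mul_le_mul_of_nonneg_right h1 (inv_pos.2 hx.1).le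
      have h3 : e * (x * deriv f x / f x) * x⁻¹ = e * (deriv f x / f x) := by
        field_simp
      linarith
  have hd0' : (0 : ℝ) < d := hd0
  have hm : d / 2 ∈ Ioo 0 d := ⟨by linarith, by linarith⟩
  have hlog := tendsto_log_nhdsGT_zero.eventually
    (eventually_lt_atBot (2 * (-a - (e * log (f (d / 2)) - 1 / 2 * log (d / 2)))))
  obtain ⟨x, hxlog, hx⟩ := (hlog.and (Ioo_mem_nhdsGT hm.1)).exists
  have hx' : x ∈ Ioo 0 d := ⟨hx.1, hx.2.trans hm.2⟩
  have h1 := hmono hx' hm hx.2.le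
  have h2 := hb x (hdS hx').2
  simp only at h1
  linarith

theorem stmt_0 (a : ℝ) (ha : 0 < a) :
    ¬ ∃ f : ℝ → ℝ,
      ContDiffOn ℝ 2 f (Ioo 0 1) ∧
      (∀ r ∈ Ioo (0:ℝ) 1, Real.exp (-a) < f r ∧ f r < 1) ∧
      (∀ r ∈ Ioo (0:ℝ) 1,
        deriv (deriv f) r + deriv f r / r - f r / r ^ 2 -
          (Real.sin (π / a * Real.log (f r)) + π / a * Real.cos (π / a * Real.log (f r))) /
            (f r * Real.sin (π / a * Real.log (f r))) *
            ((deriv f r) ^ 2 - (f r) ^ 2 / r ^ 2) = 0) ∧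
      (((∀ r ∈ Ioo (0:ℝ) 1, 0 < deriv f r) ∧
          Tendsto f (𝓝[>] (0:ℝ)) (𝓝 (Real.exp (-a))) ∧
          Tendsto f (𝓝[<] (1:ℝ)) (𝓝 1)) ∨
        ((∀ r ∈ Ioo (0:ℝ) 1, deriv f r < 0) ∧
          Tendsto f (𝓝[>] (0:ℝ)) (𝓝 1) ∧
          Tendsto f (𝓝[<] (1:ℝ)) (𝓝 (Real.exp (-a))))) := by
  rintro ⟨f, hC, hb, hode, hlim⟩
  have hpos : ∀ r ∈ Ioo (0 : ℝ) 1, 0 < f r := fun r hr => (exp_pos _).trans (hb r hr).1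
  have hlogb : ∀ r ∈ Ioo (0 : ℝ) 1, -a < log (f r) ∧ log (f r) < 0 := fun r hr =>
    ⟨(lt_log_iff_exp_lt (hpos r hr)).2 (hb r hr).1, log_neg (hpos r hr) (hb r hr).2⟩
  have hd1 : ∀ r ∈ Ioo (0 : ℝ) 1, DifferentiableAt ℝ f r := fun r hr =>
    (hC.differentiableOn (by norm_num)).differentiableAt (isOpen_Ioo.mem_nhds hr)
  have hd2 : ∀ r ∈ Ioo (0 : ℝ) 1, DifferentiableAt ℝ (deriv f) r := fun r hr =>
    ((hC.deriv_of_isOpen (m := 1) isOpen_Ioo (by norm_num)).differentiableOn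
      (by norm_num)).differentiableAt (isOpen_Ioo.mem_nhds hr)
  have hS : ∀ r ∈ Ioo (0 : ℝ) 1, sin (π / a * log (f r)) ≠ 0 := by
    intro r hr
    obtain ⟨h1, h2⟩ := hlogb r hr
    have hk : 0 < π / a := div_pos pi_pos ha
    refine (sin_neg_of_neg_of_neg_pi_lt (mul_neg_of_pos_of_neg hk h2) ?_).ne
    have h3 := mul_lt_mul_of_pos_left h1 hk
    rwa [mul_neg, div_mul_cancel₀ _ ha.ne'] at h3
  have hG := fun r hr => hasDerivAt_firstIntegral hr.1 (hpos r hr) (hd1 r hr).hasDerivAt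
    (hd2 r hr).hasDerivAt (hS r hr) (hode r hr)
  obtain ⟨c, hc⟩ := isOpen_Ioo.exists_is_const_of_deriv_eq_zero isPreconnected_Ioo
    (fun r hr => (hG r hr).differentiableAt.differentiableWithinAt) (fun r hr => (hG r hr).deriv)
  have hq : ∀ r ∈ Ioo (0 : ℝ) 1,
      (r * deriv f r / f r) ^ 2 = 1 + c * sin (π / a * log (f r)) ^ 2 := by
    intro r hr
    have h := hc r hr
    rw [div_eq_iff (pow_ne_zero 2 (hS r hr))] at h
    linarith
  have hlarge : ∀ y : ℝ, 0 < y → sin (π / a * log y) = 0 → Tendsto f (𝓝[>] 0) (𝓝 y) →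
      ∀ᶠ r in 𝓝[>] (0 : ℝ), r ∈ Ioo (0 : ℝ) 1 ∧ 1 / 2 ≤ |r * deriv f r / f r| := by
    intro y hy hsin hf
    have ht : Tendsto (fun r => 1 + c * sin (π / a * log (f r)) ^ 2) (𝓝[>] 0)
        (𝓝 (1 + c * sin (π / a * log y) ^ 2)) :=
      (((continuous_sin.tendsto _).comp ((hf.log hy.ne').const_mul _)).pow 2).const_mul c
        |>.const_add 1
    rw [hsin] at ht
    have hlt : (1 / 2 : ℝ) ^ 2 < 1 + c * 0 ^ 2 := by norm_num
    filter_upwards [ht.eventually (lt_mem_nhds hlt), Ioo_mem_nhdsGT (zero_lt_one' ℝ)] with r h hr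
    rw [← hq r hr] at h
    exact ⟨hr, (abs_of_pos (one_half_pos (α := ℝ))).symm.le.trans (sq_lt_sq.1 h).le⟩
  rcases hlim with ⟨hs, h0, -⟩ | ⟨hs, h0, -⟩
  · refine not_eventually_half_le_mul_deriv_div (a := a) (e := 1) hd1 hpos
      (fun r hr => by linarith [(hlogb r hr).1]) ?_
    have hsin : sin (π / a * log (exp (-a))) = 0 := by
      rw [log_exp, mul_neg, div_mul_cancel₀ _ ha.ne', sin_neg, sin_pi, neg_zero]
    filter_upwards [hlarge _ (exp_pos _) hsin h0] with r ⟨hr, h⟩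
    rwa [abs_of_pos (div_pos (mul_pos hr.1 (hs r hr)) (hpos r hr)),
      ← one_mul (r * deriv f r / f r)] at h
  · refine not_eventually_half_le_mul_deriv_div (a := a) (e := -1) hd1 hpos
      (fun r hr => by linarith [(hlogb r hr).2]) ?_
    filter_upwards [hlarge 1 one_pos (by simp) h0] with r ⟨hr, h⟩
    rwa [abs_of_neg (div_neg_of_neg_of_pos (mul_neg_of_pos_of_neg hr.1 (hs r hr)) (hpos r hr)),
      ← neg_one_mul] at h
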